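/- Let p be a depth-zero pattern of dimensions a×c having exactly one bifix o, and write p = p'' o where p'' has dimensions b×d (note b ≥ 1). Then for all integers n ≥ 1 and m ≥ n: s_p(n, m) = s_p(n−1, m) + s_p(n, m−1) − Σ_{i ≥ 0} (−1)^i s_p(n − a − b·i, m − c − d·i), where the sum has only finitely many nonzero terms since s_p vanishes on negative first argument. -/

import Mathlib

/-- A step of a lattice path: `u` (up) or `r` (right). -/
inductive Step : Type
  | u : Step
  | r : Step
deriving DecidableEq

/-- A word over the alphabet `{u, r}`. -/
abbrev Word := List Step

/-- The number of letters `r` in a word. -/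
def countR (w : Word) : ℕ := w.count Step.r

/-- The number of letters `u` in a word. -/
def countU (w : Word) : ℕ := w.count Step.u

/-- `dval q` = (number of `r`'s in `q`) - (number of `u`'s in `q`). -/
def dval (w : Word) : ℤ := (countR w : ℤ) - (countU w : ℤ)

/-- A pattern is depth-zero if every suffix `q` of it satisfies `dval q ≥ 0`. -/
def DepthZero (p : Word) : Prop := ∀ q : Word, q <:+ p → 0 ≤ dval q

/-- `o` is a bifix of `p`: a nonempty proper prefix of `p` that is also a (proper) suffix. -/
def IsBifix (o p : Word) : Prop := o ≠ [] ∧ o ≠ p ∧ o <+: p ∧ o <:+ p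

/-- A pattern is bifix-free if it has no bifix. -/
def BifixFree (p : Word) : Prop := ∀ o : Word, ¬ IsBifix o p

/-- `w` is a ballot path to the lattice point `(n, m)`: it has exactly `n` letters `r`
and `m` letters `u`, and every prefix has at least as many `u`'s as `r`'s. -/
def IsBallot (w : Word) (n m : ℤ) : Prop :=
  (countR w : ℤ) = n ∧ (countU w : ℤ) = m ∧
    ∀ t : Word, t <+: w → countR t ≤ countU t

/-- `w` avoids the pattern `p`: `p` does not occur in `w` as a contiguous substring. -/
def Avoids (p w : Word) : Prop := ¬ p <:+: w

/-- `s p n m` is the number of ballot paths to `(n, m)` avoiding `p`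
(`0` if `n < 0`, `m < 0`, or `m < n`, since then no such path exists). -/
noncomputable def s (p : Word) (n m : ℤ) : ℕ :=
  Set.ncard {w : Word | IsBallot w n m ∧ Avoids p w}

@[simp] theorem countR_append (v w : Word) : countR (v ++ w) = countR v + countR w :=
  List.count_append

@[simp] theorem countU_append (v w : Word) : countU (v ++ w) = countU v + countU w :=
  List.count_append

theorem length_eq_countR_add_countU (w : Word) : w.length = countR w + countU w := by
  induction w with
  | nil => rfl
  | cons x w ih => cases x <;> simp [countR, countU] at ih ⊢ <;> omega

theorem finite_setOf_isBallot (n m : ℤ) : {w : Word | IsBallot w n m}.Finite := by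
  have : Fintype Step := ⟨{Step.u, Step.r}, fun x => by cases x <;> simp⟩
  refine (List.finite_length_eq Step (n.toNat + m.toNat)).subset fun w hw => ?_
  have := length_eq_countR_add_countU w
  obtain ⟨h1, h2, -⟩ := hw
  simp only [Set.mem_ofPred_eq]
  omega

theorem IsBallot.of_append {v w : Word} {n m : ℤ} (h : IsBallot (v ++ w) n m) :
    IsBallot v (n - countR w) (m - countU w) := by
  obtain ⟨h1, h2, h3⟩ := h
  rw [countR_append] at h1
  rw [countU_append] at h2
  push_cast at h1 h2
  exact ⟨by omega, by omega, fun t ht => h3 t (ht.trans (List.prefix_append _ _))⟩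

/-- Appending a depth-zero word to a ballot path gives a ballot path
as soon as the endpoint is weakly above the diagonal. -/
theorem IsBallot.append {v w : Word} {n m : ℤ} (hw : DepthZero w) (hnm : n ≤ m)
    (hv : IsBallot v (n - countR w) (m - countU w)) : IsBallot (v ++ w) n m := by
  obtain ⟨h1, h2, h3⟩ := hv
  refine ⟨by rw [countR_append]; push_cast; omega, by rw [countU_append]; push_cast; omega,
    fun t ht => ?_⟩
  obtain ⟨z, hz⟩ := ht
  rcases List.append_eq_append_iff.1 hz with ⟨q, rfl, -⟩ | ⟨q, rfl, rfl⟩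
  · exact h3 t (List.prefix_append _ _)
  · have := hw z (List.suffix_append _ _)
    simp only [dval, countR_append, countU_append] at *
    push_cast at *
    omega

theorem isBallot_append_u {v : Word} {n m : ℤ} :
    IsBallot (v ++ [Step.u]) n m ↔ IsBallot v n (m - 1) := by
  refine ⟨fun h => by simpa [countR, countU] using h.of_append, fun ⟨h1, h2, h3⟩ => ?_⟩
  have hu : countU [Step.u] = 1 := rfl
  have hr : countR [Step.u] = 0 := rfl
  refine ⟨by rw [countR_append]; omega, by rw [countU_append]; push_cast; omega, fun t ht => ?_⟩
  rcases List.prefix_concat_iff.1 ht with rfl | h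
  · have := h3 v List.prefix_rfl
    rw [countR_append, countU_append]
    omega
  · exact h3 t h

theorem isBallot_append_r {v : Word} {n m : ℤ} (hnm : n ≤ m) :
    IsBallot (v ++ [Step.r]) n m ↔ IsBallot v (n - 1) m := by
  refine ⟨fun h => by simpa [countR, countU] using h.of_append, fun h => ?_⟩
  refine IsBallot.append (fun q hq => ?_) hnm (by simpa [countR, countU] using h)
  rcases List.suffix_cons_iff.1 hq with rfl | h
  · decide
  · rw [List.suffix_nil.1 h]; decide

/-- Every occurrence of `p` in `w` is at the end of `w`. -/
def OnlyAtEnd (p w : Word) : Prop := ∀ x y : Word, w = x ++ p ++ y → y = []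

theorem onlyAtEnd_concat {p v : Word} {x : Step} : OnlyAtEnd p (v ++ [x]) ↔ Avoids p v := by
  constructor
  · rintro h ⟨y, z, rfl⟩
    simpa using h y (z ++ [x]) (by simp)
  · intro h y z hz
    rcases List.eq_nil_or_concat z with rfl | ⟨z, t, rfl⟩
    · rfl
    · refine absurd ⟨y, z, ?_⟩ h
      rw [List.concat_eq_append, ← List.append_assoc] at hz
      exact (List.append_inj_left' hz rfl).symm

theorem OnlyAtEnd.avoids_of_append {p v w : Word} (h : OnlyAtEnd p (v ++ w)) (hw : w ≠ []) :
    Avoids p v := by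
  rintro ⟨x, y, rfl⟩
  simpa [hw] using h x (y ++ w) (by simp)

theorem Avoids.onlyAtEnd {p w : Word} (h : Avoids p w) : OnlyAtEnd p w :=
  fun x y hw => absurd ⟨x, y, hw.symm⟩ h

/-- Ballot paths to `(n, m)` in which `p` occurs at the end and nowhere else. -/
def firstHits (p : Word) (n m : ℤ) : Set Word :=
  {w | IsBallot w n m ∧ p <:+ w ∧ OnlyAtEnd p w}

theorem finite_firstHits (p : Word) (n m : ℤ) : (firstHits p n m).Finite :=
  (finite_setOf_isBallot n m).subset fun _ h => h.1

theorem finite_avoiding (p : Word) (n m : ℤ) : {w | IsBallot w n m ∧ Avoids p w}.Finite :=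
  (finite_setOf_isBallot n m).subset fun _ h => h.1

theorem firstHits_eq_empty (p : Word) {n : ℤ} (m : ℤ) (hn : n < 0) : firstHits p n m = ∅ := by
  refine Set.eq_empty_of_forall_notMem fun w hw => ?_
  have := hw.1.1
  omega

theorem s_eq_zero (p : Word) {n : ℤ} (m : ℤ) (hn : n < 0) : s p n m = 0 := by
  rw [s, Set.ncard_eq_zero (finite_avoiding p n m)]
  refine Set.eq_empty_of_forall_notMem fun w hw => ?_
  have := hw.1.1
  omega

/-- Extending the avoiding paths by one step either avoids `p` or hits it for the first time. -/
theorem s_add_ncard_firstHits (p : Word) {n m : ℤ} (hn : 1 ≤ n) (hm : n ≤ m) :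
    s p n m + (firstHits p n m).ncard = s p (n - 1) m + s p n (m - 1) := by
  have hr : Function.Injective fun v : Word => v ++ [Step.r] := fun _ _ h =>
    List.append_left_injective _ h
  have hu : Function.Injective fun v : Word => v ++ [Step.u] := fun _ _ h =>
    List.append_left_injective _ h
  rw [s, s, s, ← Set.ncard_image_of_injective {w | IsBallot w (n - 1) m ∧ Avoids p w} hr,
    ← Set.ncard_image_of_injective {w | IsBallot w n (m - 1) ∧ Avoids p w} hu,
    ← Set.ncard_union_eq _ (finite_avoiding _ _ _) (finite_firstHits _ _ _),
    ← Set.ncard_union_eq _ ((finite_avoiding _ _ _).image _) ((finite_avoiding _ _ _).image _)]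
  · congr 1
    have key : {w | IsBallot w n m ∧ Avoids p w} ∪ firstHits p n m =
        {w | IsBallot w n m ∧ OnlyAtEnd p w} := by
      ext w
      constructor
      · rintro (⟨h1, h2⟩ | ⟨h1, -, h2⟩)
        · exact ⟨h1, h2.onlyAtEnd⟩
        · exact ⟨h1, h2⟩
      · rintro ⟨h1, h2⟩
        by_cases h : Avoids p w
        · exact Or.inl ⟨h1, h⟩
        · obtain ⟨x, y, hxy⟩ := not_not.1 h
          obtain rfl := h2 x y hxy.symm
          exact Or.inr ⟨h1, ⟨x, by simpa using hxy⟩, h2⟩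
    rw [key]
    ext w
    constructor
    · rintro ⟨h1, h2⟩
      rcases List.eq_nil_or_concat w with rfl | ⟨v, x, rfl⟩
      · have := h1.1
        simp [countR] at this
        omega
      · rw [List.concat_eq_append] at h1 h2 ⊢
        rw [onlyAtEnd_concat] at h2
        cases x
        · exact Or.inr ⟨v, ⟨isBallot_append_u.1 h1, h2⟩, rfl⟩
        · exact Or.inl ⟨v, ⟨(isBallot_append_r hm).1 h1, h2⟩, rfl⟩
    · rintro (⟨v, ⟨h1, h2⟩, rfl⟩ | ⟨v, ⟨h1, h2⟩, rfl⟩)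
      · exact ⟨(isBallot_append_r hm).2 h1, onlyAtEnd_concat.2 h2⟩
      · exact ⟨isBallot_append_u.2 h1, onlyAtEnd_concat.2 h2⟩
  · rw [Set.disjoint_left]
    rintro _ ⟨v, -, rfl⟩ ⟨v', -, h⟩
    simpa using List.append_inj_right' h rfl
  · rw [Set.disjoint_left]
    rintro w ⟨-, h⟩ ⟨-, h', -⟩
    exact h h'.isInfix

/-- If `v` avoids `p`, a non-final occurrence of `p` in `v ++ p` overlaps the final one
in a bifix of `p`. -/
theorem exists_bifix_of_append_eq {p v x y : Word} (hv : Avoids p v) (hy : y ≠ [])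
    (h : v ++ p = x ++ p ++ y) : ∃ t, IsBifix t p ∧ p = t ++ y ∧ v ++ t = x ++ p := by
  rcases List.append_eq_append_iff.1 h with ⟨t, h1, h2⟩ | ⟨t, h1, h2⟩
  · refine ⟨t, ⟨?_, ?_, ⟨y, h2.symm⟩, ?_⟩, h2, h1.symm⟩
    · rintro rfl
      exact hv ⟨x, [], by simpa using h1⟩
    · rintro rfl
      exact hy (by simpa using h2)
    · refine List.suffix_of_suffix_length_le (l₃ := x ++ p) ⟨v, h1.symm⟩ (List.suffix_append _ _) ?_
      rw [h2]
      simp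
  · exact absurd ⟨x, t, h1.symm⟩ hv

/-- An avoiding path followed by `p` either hits `p` for the first time at its end,
or hit it for the first time one period of the bifix earlier. -/
theorem ncard_firstHits_add_ncard_firstHits {p o p'' : Word} (hdz : DepthZero p)
    (ho : IsBifix o p) (huniq : ∀ o' : Word, IsBifix o' p → o' = o) (hsplit : p = p'' ++ o)
    {n m : ℤ} (hm : n ≤ m) :
    (firstHits p n m).ncard + (firstHits p (n - countR p'') (m - countU p'')).ncard =
      s p (n - countR p) (m - countU p) := by
  obtain ⟨p', hp'⟩ := ho.2.2.1
  have hp'0 : p' ≠ [] := by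
    rintro rfl
    exact ho.2.1 (by simpa using hp')
  have hp0 : p ≠ [] := by
    rintro rfl
    simp_all
  have hR : countR p'' = countR p' := by
    have := congrArg countR (hp'.trans hsplit)
    simp only [countR_append] at this
    omega
  have hU : countU p'' = countU p' := by
    have := congrArg countU (hp'.trans hsplit)
    simp only [countU_append] at this
    omega
  have hdz' : DepthZero p' := fun q hq => hdz q (hq.trans ⟨o, hp'⟩)
  have eq_p' {v x y : Word} (hv : Avoids p v) (hy : y ≠ []) (h : v ++ p = x ++ p ++ y) :
      y = p' ∧ v ++ o = x ++ p := by
    obtain ⟨t, ht, h1, h2⟩ := exists_bifix_of_append_eq hv hy h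
    obtain rfl := huniq t ht
    exact ⟨List.append_cancel_left (h1.symm.trans hp'.symm), h2⟩
  rw [s, hR, hU,
    ← Set.ncard_image_of_injective {w | IsBallot w (n - countR p) _ ∧ Avoids p w}
      (f := fun v : Word => v ++ p) (fun _ _ h => List.append_left_injective _ h),
    ← Set.ncard_image_of_injective (firstHits p (n - countR p') _) (f := fun v : Word => v ++ p')
      (fun _ _ h => List.append_left_injective _ h),
    ← Set.ncard_union_eq _ (finite_firstHits _ _ _) ((finite_firstHits _ _ _).image _)]
  · congr 1
    ext w
    constructor
    · rintro (⟨h1, ⟨v, rfl⟩, h3⟩ | ⟨w, ⟨h1, ⟨v, rfl⟩, h3⟩, rfl⟩)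
      · exact ⟨v, ⟨h1.of_append, h3.avoids_of_append hp0⟩, rfl⟩
      · have e : v ++ p ++ p' = v ++ p'' ++ p := by
          calc v ++ p ++ p' = v ++ (p'' ++ o) ++ p' := by rw [← hsplit]
            _ = v ++ p'' ++ (o ++ p') := by simp
            _ = v ++ p'' ++ p := by rw [hp']
        refine ⟨v ++ p'', ⟨IsBallot.of_append ?_, ?_⟩, e.symm⟩
        · rw [← e]
          exact h1.append hdz' hm
        · refine OnlyAtEnd.avoids_of_append (w := o) ?_ ho.1
          rwa [List.append_assoc, ← hsplit]
    · rintro ⟨v, ⟨h1, h2⟩, rfl⟩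
      have hb := h1.append hdz hm
      by_cases h : OnlyAtEnd p (v ++ p)
      · exact Or.inl ⟨hb, List.suffix_append _ _, h⟩
      · simp only [OnlyAtEnd, not_forall] at h
        obtain ⟨x, y, hxy, hy⟩ := h
        obtain ⟨rfl, hx⟩ := eq_p' h2 hy hxy
        refine Or.inr ⟨x ++ p, ⟨IsBallot.of_append (hxy ▸ hb), List.suffix_append _ _, ?_⟩,
          hxy.symm⟩
        intro x' z hz
        have := (eq_p' (x := x') (y := z ++ y) h2 (by simp [hy]) (by
          rw [hxy, hz]; simp)).1
        simpa using this
  · rw [Set.disjoint_left]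
    rintro _ ⟨-, -, h⟩ ⟨w, ⟨-, ⟨v, rfl⟩, -⟩, rfl⟩
    exact hp'0 (h v p' rfl)

theorem countU_le_countR_of_isBifix {p o p'' : Word} (hdz : DepthZero p) (ho : IsBifix o p)
    (hsplit : p = p'' ++ o) : countU p'' ≤ countR p'' := by
  obtain ⟨p', hp'⟩ := ho.2.2.1
  have h := hdz p' ⟨o, hp'⟩
  have hR := congrArg countR (hp'.trans hsplit)
  have hU := congrArg countU (hp'.trans hsplit)
  simp only [countR_append, countU_append, dval] at h hR hU
  omega

/-- Recurrence for ballot paths avoiding a depth-zero pattern `p` of dimensions `a × c`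
with exactly one bifix `o`, where `p = p'' ++ o` and `p''` has dimensions `b × d`
(note `b ≥ 1`): for `n ≥ 1`, `m ≥ n`,
`s p n m = s p (n-1) m + s p n (m-1) - ∑_{i ≥ 0} (-1)^i s p (n-a-bi) (m-c-di)`
(a finite sum, since `s p` vanishes on negative first argument). -/
theorem recurrence_one_bifix (p o p'' : Word) (a c b d : ℕ)
    (hdz : DepthZero p)
    (ho : IsBifix o p) (huniq : ∀ o' : Word, IsBifix o' p → o' = o)
    (hsplit : p = p'' ++ o)
    (hdimR : countR p = a) (hdimU : countU p = c)
    (hdimR'' : countR p'' = b) (hdimU'' : countU p'' = d) (hb : 1 ≤ b)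
    (n m : ℤ) (hn : 1 ≤ n) (hm : n ≤ m) :
    (s p n m : ℤ) = (s p (n - 1) m : ℤ) + (s p n (m - 1) : ℤ) -
      ∑ᶠ i : ℕ, (-1 : ℤ) ^ i * (s p (n - a - (b : ℤ) * i) (m - c - (d : ℤ) * i) : ℤ) := by
  have hdb := countU_le_countR_of_isBifix hdz ho hsplit
  rw [hdimR'', hdimU''] at hdb
  set f : ℕ → ℤ := fun i => ((firstHits p (n - (b : ℤ) * i) (m - (d : ℤ) * i)).ncard : ℤ) with hf
  have hstep (i : ℕ) :
      (s p (n - a - (b : ℤ) * i) (m - c - (d : ℤ) * i) : ℤ) = f i + f (i + 1) := by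
    have h1 : (d : ℤ) * i ≤ b * i := by gcongr
    have h := ncard_firstHits_add_ncard_firstHits hdz ho huniq hsplit
      (n := n - (b : ℤ) * i) (m := m - (d : ℤ) * i) (by omega)
    rw [hdimR, hdimU, hdimR'', hdimU''] at h
    have e1 : n - a - (b : ℤ) * i = n - (b : ℤ) * i - a := by ring
    have e2 : m - c - (d : ℤ) * i = m - (d : ℤ) * i - c := by ring
    have e3 : n - (b : ℤ) * (i + 1 : ℕ) = n - (b : ℤ) * i - b := by push_cast; ring
    have e4 : m - (d : ℤ) * (i + 1 : ℕ) = m - (d : ℤ) * i - d := by push_cast; ring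
    simp only [hf]
    rw [e1, e2, e3, e4, ← h]
    push_cast
    rfl
  have hneg (i : ℕ) (hi : n.toNat + 1 ≤ i) : n - (b : ℤ) * i < 0 := by
    have : (1 : ℤ) * i ≤ b * i := by gcongr; exact_mod_cast hb
    omega
  have hsum (N : ℕ) : ∑ i ∈ Finset.range N, (-1 : ℤ) ^ i * (f i + f (i + 1)) =
      f 0 - (-1) ^ N * f N := by
    induction N with
    | zero => simp
    | succ N ih => rw [Finset.sum_range_succ, ih]; ring
  have hfN : f (n.toNat + 1) = 0 := by
    simp only [hf]
    rw [firstHits_eq_empty p _ (hneg _ le_rfl)]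
    simp
  rw [finsum_eq_sum_of_support_subset (s := Finset.range (n.toNat + 1))]
  · simp only [hstep]
    rw [hsum, hfN]
    have h := s_add_ncard_firstHits p hn hm
    have h0 : f 0 = (firstHits p n m).ncard := by simp [hf]
    rw [h0]
    omega
  · intro i hi
    by_contra h
    simp only [Finset.coe_range, Set.mem_Iio, not_lt] at h
    have := hneg i h
    rw [Function.mem_support, s_eq_zero p _ (by omega)] at hi
    simp at hi
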